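/- arXiv:1602.00249 — 2 statements merged into one kernel-verified Lean document; each statement's English description precedes it below -/
import Mathlib

section
/- Let (W, N, Y) be a one-variable Deligne system on V and let Y' be the unique grading of W with [Y, Y'] = 0 having the Deligne grading property. Write N = Σ_j N_j where N_j is the component of N in the j-eigenspace of ad Y' on End(V). Then N_{−1} = 0; in fact N − N₀ lies in the sum of the j-eigenspaces of ad Y' with j ≤ −2. -/
/-- An increasing filtration of `V`: an increasing family of subspaces indexed by `ℤ`,
eventually `⊥` below and eventually `⊤` above. -/
def IsIncFilt {K V : Type} [Field K] [AddCommGroup V] [Module K V]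
    (W : ℤ → Submodule K V) : Prop :=
  Monotone W ∧ (∃ a : ℤ, ∀ k ≤ a, W k = ⊥) ∧ (∃ b : ℤ, ∀ k, b ≤ k → W k = ⊤)

/-- The `j`-eigenspace `E_j(Y) = ker (Y - j·1)` of an endomorphism, for an integer `j`. -/
def intEig {K V : Type} [Field K] [AddCommGroup V] [Module K V]
    (Y : Module.End K V) (j : ℤ) : Submodule K V :=
  LinearMap.ker (Y - (j : K) • (1 : Module.End K V))

/-- `Y` is a grading of the filtration `W`: `Y` is semisimple with integer eigenvalues
(`V` is the direct sum of the integer eigenspaces, whose mutual independence is automatic)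
and `W k = ⊕_{j ≤ k} E_j(Y)` for all `k`. -/
def IsGrading {K V : Type} [Field K] [AddCommGroup V] [Module K V]
    (Y : Module.End K V) (W : ℤ → Submodule K V) : Prop :=
  (⨆ j : ℤ, intEig Y j) = ⊤ ∧ ∀ k : ℤ, W k = ⨆ j ≤ k, intEig Y j

/-- The adjoint action `ad Y = [Y, ·]` on `End(V)`. -/
def adE {K V : Type} [Field K] [AddCommGroup V] [Module K V]
    (Y : Module.End K V) : Module.End K (Module.End K V) :=
  LinearMap.mulLeft K Y - LinearMap.mulRight K Y

/-- `M` is the relative weight filtration of `N` with respect to `W`: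
`N(M_k) ⊆ M_{k-2}`, and for all `k ∈ ℤ` and `ℓ ≥ 0` the map induced by `N^ℓ` from
`Gr^M_{k+ℓ} Gr^W_k` to `Gr^M_{k-ℓ} Gr^W_k` is an isomorphism (expressed here as surjectivity
and injectivity conditions on the corresponding submodules of `V`). -/
def IsRelWeightFilt {K V : Type} [Field K] [AddCommGroup V] [Module K V]
    (N : Module.End K V) (W M : ℤ → Submodule K V) : Prop :=
  (∀ k : ℤ, Submodule.map N (M k) ≤ M (k - 2)) ∧
  ∀ (k : ℤ) (ℓ : ℕ),
    (M (k - ℓ) ⊓ W k ≤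
      Submodule.map (N ^ ℓ) (M (k + ℓ) ⊓ W k) ⊔ ((M (k - ℓ - 1) ⊓ W k) ⊔ W (k - 1))) ∧
    ((M (k + ℓ) ⊓ W k) ⊓
        Submodule.comap (N ^ ℓ) ((M (k - ℓ - 1) ⊓ W k) ⊔ W (k - 1)) ≤
      (M (k + ℓ - 1) ⊓ W k) ⊔ W (k - 1))

/-- A one-variable Deligne system `(W, N, Y)`: `W` an increasing filtration, `N` a nilpotent
endomorphism preserving `W`, and `Y` a grading of an increasing filtration `M` of `V` such
that `Y` preserves `W`, `[Y, N] = -2N`, and `M` is the relative weight filtration of `N`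
with respect to `W`. -/
def IsDeligneSystem1 {K V : Type} [Field K] [AddCommGroup V] [Module K V]
    (W : ℤ → Submodule K V) (N Y : Module.End K V) : Prop :=
  IsIncFilt W ∧ IsNilpotent N ∧ (∀ k : ℤ, Submodule.map N (W k) ≤ W k) ∧
  ∃ M : ℤ → Submodule K V, IsIncFilt M ∧ IsGrading Y M ∧
    (∀ k : ℤ, Submodule.map Y (W k) ≤ W k) ∧ (Y * N - N * Y = -(2 • N)) ∧
    IsRelWeightFilt N W M

/-- `N₀` is the component of `N` in the `0`-eigenspace of `ad Y'`: `[Y', N₀] = 0` and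
`N - N₀` lies in the sum of the nonzero integer eigenspaces of `ad Y'`. -/
def IsZeroComponent {K V : Type} [Field K] [AddCommGroup V] [Module K V]
    (Y' N N₀ : Module.End K V) : Prop :=
  adE Y' N₀ = 0 ∧
  N - N₀ ∈ ⨆ j ∈ {j : ℤ | j ≠ 0},
    LinearMap.ker (adE Y' - (j : K) • (1 : Module.End K (Module.End K V)))

/-- `(N⁺, Y, N)` is a standard triple: `[Y, N⁺] = 2N⁺`, `[N⁺, N] = Y`, `[Y, N] = -2N`. -/
def IsStdTriple {K V : Type} [Field K] [AddCommGroup V] [Module K V]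
    (Np Y N : Module.End K V) : Prop :=
  Y * Np - Np * Y = 2 • Np ∧ Np * N - N * Np = Y ∧ Y * N - N * Y = -(2 • N)

/-- `Y'` has the Deligne grading property for `(N, Y)`: there exist `N₀⁺` commuting with `Y'`
such that `(N₀⁺, Y - Y', N₀)` is a standard triple and `[N - N₀, N₀⁺] = 0`, where `N₀` is the
component of `N` in the `0`-eigenspace of `ad Y'`. -/
def HasDGP {K V : Type} [Field K] [AddCommGroup V] [Module K V]
    (N Y Y' : Module.End K V) : Prop :=
  ∃ N₀ Np : Module.End K V, IsZeroComponent Y' N N₀ ∧ adE Y' Np = 0 ∧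
    IsStdTriple Np (Y - Y') N₀ ∧ (N - N₀) * Np = Np * (N - N₀)

theorem adE_apply {K V : Type} [Field K] [AddCommGroup V] [Module K V]
    (Y A : Module.End K V) : adE Y A = Y * A - A * Y := rfl

/-- The zero component of an endomorphism for a given grading is unique. -/
theorem IsZeroComponent.unique {K V : Type} [Field K] [CharZero K] [AddCommGroup V] [Module K V]
    {Y' N N₀ N₁ : Module.End K V} (h₀ : IsZeroComponent Y' N N₀) (h₁ : IsZeroComponent Y' N N₁) :
    N₀ = N₁ := by
  have hle : (⨆ j ∈ {j : ℤ | j ≠ 0},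
      LinearMap.ker (adE Y' - (j : K) • (1 : Module.End K (Module.End K V)))) ≤
      ⨆ (μ : K) (_ : μ ≠ 0), (adE Y').eigenspace μ := by
    refine iSup₂_le fun j hj => ?_
    refine le_trans ?_ (le_iSup₂ (f := fun (μ : K) (_ : μ ≠ 0) => (adE Y').eigenspace μ)
      (j : K) (Int.cast_ne_zero.mpr hj))
    rw [Module.End.eigenspace_def]
  have hsub : N₀ - N₁ ∈ ⨆ (μ : K) (_ : μ ≠ 0), (adE Y').eigenspace μ := by
    have := sub_mem (hle h₁.2) (hle h₀.2)
    rwa [sub_sub_sub_cancel_left] at this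
  have hker : N₀ - N₁ ∈ (adE Y').eigenspace 0 := by
    rw [Module.End.mem_eigenspace_iff, map_sub, h₀.1, h₁.1, sub_zero, zero_smul]
  exact sub_eq_zero.mp (Submodule.disjoint_def.mp
    ((Module.End.eigenspaces_iSupIndep (adE Y')) 0) _ hker hsub)

/-- A highest weight vector for the adjoint action of a standard triple has weight in `ℕ`. -/
theorem IsStdTriple.exists_nat_weight {K V : Type} [Field K] [CharZero K] [AddCommGroup V]
    [Module K V] [FiniteDimensional K V] {Np H Nm B : Module.End K V} {c : K}
    (ht : IsStdTriple Np H Nm) (hB : B ≠ 0) (hc : H * B - B * H = c • B)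
    (hp : Np * B = B * Np) : ∃ n : ℕ, c = n := by
  obtain ⟨h1, h2, h3⟩ := ht
  by_cases hH : H = 0
  · refine ⟨0, ?_⟩
    have : c • B = 0 := by rw [← hc, hH, zero_mul, mul_zero, sub_zero]
    simpa [hB] using this
  · let _ : LieRing (Module.End K V) := LieRing.ofAssociativeRing
    have t : IsSl2Triple H Np Nm :=
      { h_ne_zero := hH
        lie_e_f := by rw [Ring.lie_def, h2]
        lie_h_e_nsmul := by rw [Ring.lie_def, h1]
        lie_h_f_nsmul := by rw [Ring.lie_def, h3] }
    have P : t.HasPrimitiveVectorWith B c :=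
      { ne_zero := hB
        lie_h := by rw [Ring.lie_def, hc]
        lie_e := by rw [Ring.lie_def, hp, sub_self] }
    exact P.exists_nat

/-- Let `(W, N, Y)` be a one-variable Deligne system and `Y'` the grading of
`W` commuting with `Y` that has the Deligne grading property.  Writing `N = Σ_j N_j` in
`ad Y'`-eigencomponents, `N_{-1} = 0`; in fact `N - N₀` lies in the sum of the
`j`-eigenspaces of `ad Y'` with `j ≤ -2`. -/
theorem stmt10 {K V : Type} [Field K] [CharZero K] [AddCommGroup V] [Module K V]
    [FiniteDimensional K V]
    (W : ℤ → Submodule K V) (N Y : Module.End K V)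
    (hDS : IsDeligneSystem1 W N Y)
    (Y' : Module.End K V)
    (hgr : IsGrading Y' W) (hcomm : Y * Y' = Y' * Y) (hDGP : HasDGP N Y Y')
    (N₀ : Module.End K V) (hN₀ : IsZeroComponent Y' N N₀) :
    N - N₀ ∈ ⨆ j ∈ {j : ℤ | j ≤ -2},
      LinearMap.ker (adE Y' - (j : K) • (1 : Module.End K (Module.End K V))) := by
  obtain ⟨N₁, Np, hN₁, hNp, ht, hA⟩ := hDGP
  obtain rfl := hN₁.unique hN₀
  obtain ⟨-, -, -, -, -, -, -, hYN, -⟩ := hDS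
  have hN₁c : Y' * N₁ = N₁ * Y' := by rw [← sub_eq_zero, ← adE_apply, hN₁.1]
  have hNpc : Y' * Np = Np * Y' := by rw [← sub_eq_zero, ← adE_apply, hNp]
  have hYN₁ : Y * N₁ - N₁ * Y = -(2 • N₁) := by
    rw [← ht.2.2, sub_mul, mul_sub, hN₁c]
    abel
  -- the space (stable under the grading) of `Np`-invariant endomorphisms of `ad Y`-weight `-2`
  let P : Submodule K (Module.End K V) :=
    LinearMap.ker (adE Y + (2 : K) • 1) ⊓ LinearMap.ker (adE Np)
  have hP (B : Module.End K V) : B ∈ P ↔ Y * B - B * Y + 2 * B = 0 ∧ Np * B - B * Np = 0 := by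
    simp [P, adE_apply, ofNat_smul_eq_nsmul, two_mul]
  have hPinv : ∀ B ∈ P, adE Y' B ∈ P := by
    intro B hB
    rw [hP] at hB ⊢
    have e1 : Y * adE Y' B - adE Y' B * Y + 2 * adE Y' B = adE Y' (Y * B - B * Y + 2 * B) := by
      simp only [adE_apply]
      linear_combination (norm := noncomm_ring) hcomm * B - B * hcomm
    have e2 : Np * adE Y' B - adE Y' B * Np = adE Y' (Np * B - B * Np) := by
      simp only [adE_apply]
      linear_combination (norm := noncomm_ring) B * hNpc - hNpc * B
    rw [e1, e2, hB.1, hB.2, map_zero]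
    exact ⟨rfl, rfl⟩
  have hAP : N - N₁ ∈ P := by
    rw [hP]
    refine ⟨?_, sub_eq_zero.mpr hA.symm⟩
    rw [nsmul_eq_mul] at hYN hYN₁
    push_cast at hYN hYN₁
    linear_combination (norm := noncomm_ring) hYN - hYN₁
  have hAsup : N - N₁ ∈ ⨆ μ : K, (adE Y').eigenspace μ := by
    refine SetLike.le_def.mp (iSup₂_le fun j _ => ?_) hN₁.2
    refine le_trans ?_ (le_iSup (adE Y').eigenspace (j : K))
    rw [Module.End.eigenspace_def]
  have hmem : N - N₁ ∈ ⨆ μ : K, P ⊓ (adE Y').eigenspace μ := by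
    rw [← Submodule.inf_iSup_genEigenspace hPinv]
    exact ⟨hAP, hAsup⟩
  refine SetLike.le_def.mp (iSup_le fun μ B hB => ?_) hmem
  obtain ⟨hBP, hBμ⟩ := hB
  by_cases hB0 : B = 0
  · rw [hB0]
    exact zero_mem _
  rw [SetLike.mem_coe, hP] at hBP
  have hBμ' := Module.End.mem_eigenspace_iff.mp hBμ
  obtain ⟨n, hn⟩ := ht.exists_nat_weight (c := -2 - μ) hB0 (by
    rw [adE_apply] at hBμ'
    rw [sub_smul, ← hBμ', neg_smul, ofNat_smul_eq_nsmul, two_nsmul]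
    linear_combination (norm := noncomm_ring) hBP.1) (sub_eq_zero.mp hBP.2)
  have hμ : μ = ((-2 - n : ℤ) : K) := by
    push_cast
    linear_combination -hn
  refine Submodule.mem_iSup_of_mem (-2 - n : ℤ) (Submodule.mem_iSup_of_mem ?_ ?_)
  · simp
  · rw [← hμ, ← Module.End.eigenspace_def]
    exact hBμ
end

section
/- Let (W, N, Y) be a one-variable Deligne system on V and (W̃, Ñ, Ỹ) a one-variable Deligne system on Ṽ, and let T : V → Ṽ be a linear map with T(W_i) ⊆ W̃_i for all i, Ỹ ∘ T = T ∘ Y, and Ñ ∘ T = T ∘ N. If Y' and Ỹ' are gradings of W and W̃ having the Deligne grading property for the respective systems, then Ỹ' ∘ T = T ∘ Y'. -/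
section Eigenspaces

variable {K H : Type*} [Field K] [CharZero K] [AddCommGroup H] [Module K H]

theorem iSupIndep_intCast_eigenspace (A : Module.End K H) :
    iSupIndep fun j : ℤ => A.eigenspace (j : K) :=
  A.eigenspaces_iSupIndep.comp Int.cast_injective

/-- If a sum of eigenvectors with integer eigenvalues vanishes, then so does the partial sum
over any single eigenvalue. -/
theorem sum_eigenvalue_eq_zero {ι : Type*} (A : Module.End K H) (s : Finset ι) (w : ι → ℤ)
    (v : ι → H) (hv : ∀ i ∈ s, A (v i) = (w i : K) • v i) (h : ∑ i ∈ s, v i = 0) (m : ℤ) :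
    ∑ i ∈ s with w i = m, v i = 0 := by
  have h₁ : ∑ i ∈ s with w i = m, v i ∈ A.eigenspace (m : K) :=
    Submodule.sum_mem _ fun i hi => by
      obtain ⟨his, rfl⟩ := Finset.mem_filter.1 hi
      exact Module.End.mem_eigenspace_iff.2 (hv i his)
  have h₂ : ∑ i ∈ s with ¬ w i = m, v i ∈ ⨆ j ≠ m, A.eigenspace (j : K) :=
    Submodule.sum_mem _ fun i hi => by
      obtain ⟨his, hne⟩ := Finset.mem_filter.1 hi
      exact Submodule.mem_iSup_of_mem (w i)
        (Submodule.mem_iSup_of_mem hne (Module.End.mem_eigenspace_iff.2 (hv i his)))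
  have h₃ := Finset.sum_filter_add_sum_filter_not s (fun i => w i = m) v
  rw [h] at h₃
  refine (Submodule.disjoint_def.1 (iSupIndep_intCast_eigenspace A m)) _ h₁ ?_
  rw [eq_neg_of_add_eq_zero_left h₃]
  exact Submodule.neg_mem _ h₂

theorem eq_zero_of_sum_eq_zero_of_weights (A : Module.End K H) (s : Finset ℕ) (v : ℕ → H)
    (hv : ∀ i ∈ s, A (v i) = -(i : K) • v i) (h : ∑ i ∈ s, v i = 0) (i : ℕ) (hi : i ∈ s) :
    v i = 0 := by
  have := sum_eigenvalue_eq_zero A s (fun i => -(i : ℤ)) v (by simpa using hv) h (-(i : ℤ))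
  rwa [Finset.sum_eq_single_of_mem i (by simp [hi])] at this
  intro j hj hne
  simp only [Finset.mem_filter, neg_inj, Nat.cast_inj] at hj
  exact absurd hj.2 hne

/-- A vector of positive weight killed by `E F` vanishes, for `E, F` part of an `sl₂`-triple. -/
theorem eq_zero_of_raise_lower_eq_zero [FiniteDimensional K H] {E D F : Module.End K H}
    (hDE : ∀ v, D (E v) = E (D v) + (2 : K) • E v) (hEF : ∀ v, E (F v) = F (E v) + D v)
    (m : ℕ) (hm : 0 < m) (x : H) (hx : D x = (m : K) • x) (h : E (F x) = 0) : x = 0 := by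
  have hwt : ∀ j : ℕ, D ((E ^ j) x) = ((m + 2 * j : ℕ) : K) • (E ^ j) x := by
    intro j
    induction j with
    | zero => simpa using hx
    | succ j ih =>
      rw [pow_succ', Module.End.mul_apply, hDE, ih, map_smul, ← add_smul]
      congr 1
      push_cast
      ring
  have hlow : ∀ j : ℕ, ∃ c : ℕ, 0 < c ∧ F ((E ^ (j + 1)) x) = -((c : K) • (E ^ j) x) := by
    intro j
    induction j with
    | zero =>
      refine ⟨m, hm, ?_⟩
      rw [hEF, hx] at h
      simpa using eq_neg_of_add_eq_zero_left h
    | succ j ih =>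
      obtain ⟨c, hc, hj⟩ := ih
      refine ⟨c + (m + 2 * (j + 1)), by omega, ?_⟩
      have h₁ := hEF ((E ^ (j + 1)) x)
      rw [hj, hwt, map_neg, map_smul, ← Module.End.mul_apply, ← pow_succ',
        ← Module.End.mul_apply E (E ^ (j + 1)), ← pow_succ'] at h₁
      rw [← sub_eq_iff_eq_add] at h₁
      rw [← h₁, Nat.cast_add c, add_smul]
      abel
  by_contra hx0
  have hne : ∀ j : ℕ, (E ^ j) x ≠ 0 := by
    intro j
    induction j with
    | zero => simpa using hx0
    | succ j ih =>
      intro h0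
      obtain ⟨c, hc, hj⟩ := hlow j
      rw [h0, map_zero, eq_comm, neg_eq_zero, smul_eq_zero, Nat.cast_eq_zero] at hj
      exact hj.elim hc.ne' ih
  have hli : LinearIndependent K fun j : ℕ => (E ^ j) x := by
    refine Module.End.eigenvectors_linearIndependent' D (fun j : ℕ => ((m + 2 * j : ℕ) : K)) ?_ _
      fun j => ⟨Module.End.mem_eigenspace_iff.2 (hwt j), hne j⟩
    intro i j hij
    have := Nat.cast_injective hij
    omega
  have := hli.finite
  exact not_finite ℕ

/-- Let `E`, `D = A' - A`, `B 0` be an `sl₂`-triple, `B k` of weight `-k` for `ad A` and commuting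
with `E` for `k ≥ 1`, and `v k` of weight `-k` for `A` and `0` for `A'`. If
`(∑ B i) (∑ v j) = 0`, then `v k = 0` for `k ≥ 1`. -/
theorem components_eq_zero [FiniteDimensional K H] {A D E : Module.End K H}
    {B : ℕ → Module.End K H} {v : ℕ → H} {n : ℕ}
    (hDE : ∀ v, D (E v) = E (D v) + (2 : K) • E v)
    (hEB : ∀ v, E (B 0 v) = B 0 (E v) + D v)
    (hAB : ∀ k v, A (B k v) = B k (A v) - (k : K) • B k v)
    (hcomm : ∀ k, 1 ≤ k → ∀ v, E (B k v) = B k (E v))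
    (hA : ∀ k, A (v k) = -(k : K) • v k)
    (hD : ∀ k < n, D (v k) = (k : K) • v k)
    (h : ∑ i ∈ Finset.range n, B i (∑ j ∈ Finset.range n, v j) = 0) :
    ∀ k < n, 1 ≤ k → v k = 0 := by
  have hdeg : ∀ m : ℕ, ∑ p ∈ Finset.range n ×ˢ Finset.range n with p.1 + p.2 = m,
      B p.1 (v p.2) = 0 := by
    intro m
    have := sum_eigenvalue_eq_zero A (Finset.range n ×ˢ Finset.range n)
      (fun p => -((p.1 + p.2 : ℕ) : ℤ)) (fun p => B p.1 (v p.2)) ?_ ?_ (-(m : ℤ))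
    · simpa only [neg_inj, Nat.cast_inj] using this
    · intro p _
      rw [hAB, hA, map_smul, ← sub_smul]
      congr 1
      push_cast
      ring
    · rw [Finset.sum_product]
      simpa only [map_sum] using h
  intro k hk hk1
  have hn : 0 < n := by omega
  have hB0 : B 0 (v 0) = 0 := by
    have := hdeg 0
    rwa [Finset.sum_eq_single_of_mem (0, 0) (by simp [hn])] at this
    rintro ⟨i, j⟩ hp hne
    simp_all
  have hE0 : E (v 0) = 0 := by
    have hD0 : D (v 0) = 0 := by simpa using hD 0 hn
    have hBE : B 0 (E (v 0)) = 0 := by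
      simpa [hB0, hD0] using (hEB (v 0)).symm
    refine eq_zero_of_raise_lower_eq_zero hDE hEB 2 two_pos _ ?_ ?_
    · rw [hDE, hD0]
      simp
    · rw [hBE, map_zero]
  induction k using Nat.strong_induction_on with
  | _ k ih =>
    have hk2 : B 0 (v k) + B k (v 0) = 0 := by
      rw [← hdeg k, ← Finset.sum_pair (f := fun p : ℕ × ℕ => B p.1 (v p.2))
        (a := (0, k)) (b := (k, 0)) (by simp; omega)]
      refine Finset.sum_subset ?_ ?_
      · intro p hp
        simp only [Finset.mem_insert, Finset.mem_singleton] at hp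
        rcases hp with rfl | rfl <;> simp [hk, hn]
      · rintro ⟨i, j⟩ hp hp'
        simp only [Finset.mem_filter, Finset.mem_product, Finset.mem_range] at hp
        simp only [Finset.mem_insert, Finset.mem_singleton, Prod.mk.injEq, not_or] at hp'
        rw [ih j (by omega) (by omega) (by omega), map_zero]
    refine eq_zero_of_raise_lower_eq_zero hDE hEB k hk1 _ (hD k hk) ?_
    rw [eq_neg_of_add_eq_zero_left hk2, map_neg, hcomm k hk1, hE0, map_zero, neg_zero]

end Eigenspaces

section Gradings

variable {K V Vt : Type} [Field K] [AddCommGroup V] [Module K V] [AddCommGroup Vt] [Module K Vt]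

theorem mem_intEig_iff {Y : Module.End K V} {j : ℤ} {v : V} :
    v ∈ intEig Y j ↔ Y v = (j : K) • v := by
  simp [intEig, sub_eq_zero]

theorem intEig_eq_eigenspace (Y : Module.End K V) (j : ℤ) : intEig Y j = Y.eigenspace (j : K) := by
  ext v
  rw [mem_intEig_iff, Module.End.mem_eigenspace_iff]

/-- The map `T ↦ Xt ∘ T - T ∘ X` on `Hom(V, Vt)`. -/
def homBracket (Xt : Module.End K Vt) (X : Module.End K V) : Module.End K (V →ₗ[K] Vt) :=
  LinearMap.compRight K Xt - LinearMap.lcomp K Vt X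

theorem homBracket_apply (Xt : Module.End K Vt) (X : Module.End K V) (T : V →ₗ[K] Vt) :
    homBracket Xt X T = Xt ∘ₗ T - T ∘ₗ X := rfl

theorem homBracket_homBracket (Xt Zt : Module.End K Vt) (X Z : Module.End K V)
    (T : V →ₗ[K] Vt) : homBracket Xt X (homBracket Zt Z T) =
      homBracket Zt Z (homBracket Xt X T)
        + homBracket (Xt * Zt - Zt * Xt) (X * Z - Z * X) T := by
  ext v
  simp only [homBracket_apply, LinearMap.sub_apply, LinearMap.add_apply, LinearMap.comp_apply,
    Module.End.mul_apply, map_sub]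
  abel

theorem homBracket_self (X Z : Module.End K V) : homBracket X X Z = X * Z - Z * X := rfl

variable [CharZero K] [FiniteDimensional K V] [FiniteDimensional K Vt]

/-- The spectral projections of an endomorphism that is diagonalizable over `ℤ`. -/
theorem exists_eigenprojections {Y : Module.End K V} (h : (⨆ j : ℤ, intEig Y j) = ⊤) :
    ∃ (s : Finset ℤ) (p : ℤ → Module.End K V), ∑ a ∈ s, p a = 1 ∧
      (∀ a ∈ s, Y * p a = (a : K) • p a) ∧ ∀ a ∈ s, p a * Y = (a : K) • p a := by
  classical
  have hind : iSupIndep fun j : ℤ => intEig Y j := by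
    simpa only [intEig_eq_eigenspace] using iSupIndep_intCast_eigenspace Y
  have hfin : {j : ℤ | intEig Y j ≠ ⊥}.Finite := WellFoundedGT.finite_ne_bot_of_iSupIndep hind
  have hinj : Set.InjOn (fun j : ℤ => (j : K)) hfin.toFinset := Int.cast_injective.injOn
  set s := hfin.toFinset with hs
  have hann : Polynomial.aeval Y (Lagrange.nodal s fun j : ℤ => (j : K)) = 0 := by
    rw [← LinearMap.ker_eq_top, eq_top_iff, ← h, iSup_le_iff]
    intro j v hv
    by_cases hj : intEig Y j = ⊥
    · rw [hj, Submodule.mem_bot] at hv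
      simp [hv]
    · have hjs : j ∈ s := by simpa [hs] using hj
      rw [LinearMap.mem_ker, Lagrange.nodal_eq_mul_nodal_erase hjs, mul_comm, map_mul,
        Module.End.mul_apply]
      rw [mem_intEig_iff] at hv
      simp [hv, Int.cast_smul_eq_zsmul]
  have hmul : ∀ a ∈ s, (Polynomial.aeval Y)
      ((Polynomial.X - Polynomial.C (a : K)) * Lagrange.basis s (fun j : ℤ => (j : K)) a) = 0 := by
    intro a ha
    rw [Lagrange.basis_eq_prod_sub_inv_mul_nodal_div ha, mul_left_comm,
      ← Lagrange.nodal_erase_eq_nodal_div ha, ← Lagrange.nodal_eq_mul_nodal_erase ha, map_mul,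
      hann, mul_zero]
  by_cases hne : s.Nonempty
  · refine ⟨s, fun a => Polynomial.aeval Y (Lagrange.basis s (fun j : ℤ => (j : K)) a), ?_, ?_, ?_⟩
    · rw [← map_sum, Lagrange.sum_basis hinj hne, map_one]
    · intro a ha
      have := hmul a ha
      rw [map_mul, map_sub, Polynomial.aeval_X, Polynomial.aeval_C, sub_mul, sub_eq_zero] at this
      rw [this, Algebra.smul_def]
    · intro a ha
      have := hmul a ha
      rw [mul_comm, map_mul, map_sub, Polynomial.aeval_X, Polynomial.aeval_C, mul_sub,
        sub_eq_zero] at this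
      rw [this, Algebra.smul_def, Algebra.commutes]
  · rw [Finset.not_nonempty_iff_eq_empty] at hne
    refine ⟨∅, 0, ?_, by simp, by simp⟩
    rw [hne, Lagrange.nodal_empty, map_one] at hann
    simpa using hann.symm

/-- A filtered map is a sum of components of nonpositive weight. -/
theorem exists_components_of_filtered {W : ℤ → Submodule K V} {Wt : ℤ → Submodule K Vt}
    {Y : Module.End K V} {Yt : Module.End K Vt} (hY : IsGrading Y W) (hYt : IsGrading Yt Wt)
    (T : V →ₗ[K] Vt) (hT : ∀ i : ℤ, Submodule.map T (W i) ≤ Wt i) :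
    ∃ (f : ℕ → V →ₗ[K] Vt) (n₀ : ℕ), (∀ k, homBracket Yt Y (f k) = -(k : K) • f k) ∧
      ∀ n, n₀ ≤ n → ∑ k ∈ Finset.range n, f k = T := by
  obtain ⟨s, p, hp1, hYp, hpY⟩ := exists_eigenprojections hY.1
  obtain ⟨t, q, hq1, hYq, hqY⟩ := exists_eigenprojections hYt.1
  have hpW : ∀ a ∈ s, ∀ v, p a v ∈ W a := by
    intro a ha v
    rw [hY.2 a]
    exact Submodule.mem_iSup_of_mem a (Submodule.mem_iSup_of_mem le_rfl
      (mem_intEig_iff.2 (LinearMap.congr_fun (hYp a ha) v)))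
  have hqW : ∀ a, ∀ b ∈ t, a < b → Wt a ≤ LinearMap.ker (q b) := by
    intro a b hb hab
    rw [hYt.2 a]
    refine iSup₂_le fun j hj w hw => ?_
    have h₁ := LinearMap.congr_fun (hqY b hb) w
    rw [mem_intEig_iff] at hw
    rw [Module.End.mul_apply, hw, map_smul, LinearMap.smul_apply, ← sub_eq_zero, ← sub_smul,
      smul_eq_zero, sub_eq_zero, Int.cast_inj] at h₁
    exact h₁.resolve_left (by omega)
  have hT' : T = ∑ a ∈ s, ∑ b ∈ t, q b ∘ₗ T ∘ₗ p a := by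
    ext v
    have h₁ : ∀ w, ∑ b ∈ t, q b w = w := fun w => by
      simpa using LinearMap.congr_fun hq1 w
    have h₂ : ∑ a ∈ s, p a v = v := by simpa using LinearMap.congr_fun hp1 v
    simp only [LinearMap.sum_apply, LinearMap.comp_apply, h₁]
    rw [← map_sum, h₂]
  have hmem : T ∈ ⨆ k : ℕ, (homBracket Yt Y).eigenspace (-(k : K)) := by
    rw [hT']
    refine Submodule.sum_mem _ fun a ha => Submodule.sum_mem _ fun b hb => ?_
    rcases lt_or_ge a b with hab | hab
    · have : q b ∘ₗ T ∘ₗ p a = 0 := by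
        ext v
        exact hqW a b hb hab (hT a (Submodule.mem_map_of_mem (hpW a ha v)))
      rw [this]
      exact Submodule.zero_mem _
    · refine Submodule.mem_iSup_of_mem (a - b).toNat (Module.End.mem_eigenspace_iff.2 ?_)
      have hk : (((a - b).toNat : ℕ) : K) = (a : K) - b := by
        rw [← Int.cast_sub, ← Int.cast_natCast, Int.toNat_of_nonneg (by omega)]
      rw [hk]
      ext v
      have h₁ := LinearMap.congr_fun (hYq b hb) (T (p a v))
      have h₂ := LinearMap.congr_fun (hpY a ha) v
      simp only [Module.End.mul_apply, LinearMap.smul_apply] at h₁ h₂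
      simp only [homBracket_apply, LinearMap.sub_apply, LinearMap.comp_apply,
        LinearMap.smul_apply, h₁, h₂, map_smul]
      module
  obtain ⟨f, hf, hsum⟩ := (Submodule.mem_iSup_iff_exists_finsupp _ _).1 hmem
  refine ⟨f, f.support.sup id + 1, fun k => Module.End.mem_eigenspace_iff.1 (hf k), ?_⟩
  intro n hn
  rw [← hsum, Finsupp.sum]
  refine (Finset.sum_subset ?_ ?_).symm
  · intro k hk
    have := Finset.le_sup (f := id) hk
    rw [Finset.mem_range]
    simp only [id] at this
    omega
  · intro k _ hk
    exact Finsupp.notMem_support_iff.1 hk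

/-- The components of `N` with respect to a grading having the Deligne grading property. -/
theorem exists_components_of_zeroComponent {W : ℤ → Submodule K V} {N N₀ Np Y' : Module.End K V}
    (hY' : IsGrading Y' W) (hN : ∀ k : ℤ, Submodule.map N (W k) ≤ W k)
    (h₀ : IsZeroComponent Y' N N₀) (hp : adE Y' Np = 0) (hc : (N - N₀) * Np = Np * (N - N₀)) :
    ∃ (f : ℕ → Module.End K V) (n₀ : ℕ), f 0 = N₀ ∧
      (∀ k, Y' * f k - f k * Y' = -(k : K) • f k) ∧
      (∀ k, 1 ≤ k → Np * f k - f k * Np = 0) ∧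
      ∀ n, n₀ ≤ n → ∑ k ∈ Finset.range n, f k = N := by
  obtain ⟨f, n₀, hf, hsum⟩ := exists_components_of_filtered hY' hY' N hN
  have hf0 : f 0 = N₀ := by
    have h₁ : f 0 - N₀ ∈ (homBracket Y' Y').eigenspace ((0 : ℤ) : K) := by
      rw [Module.End.mem_eigenspace_iff, map_sub, hf 0,
        show homBracket Y' Y' N₀ = 0 from h₀.1]
      simp
    have h₂ : N - N₀ ∈ ⨆ j ≠ (0 : ℤ), (homBracket Y' Y').eigenspace (j : K) := by
      refine SetLike.le_def.1 (iSup₂_mono fun j _ => ?_) h₀.2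
      intro X hX
      rw [Module.End.mem_eigenspace_iff, ← sub_eq_zero]
      exact hX
    have h₃ : N - f 0 ∈ ⨆ j ≠ (0 : ℤ), (homBracket Y' Y').eigenspace (j : K) := by
      rw [← hsum (n₀ + 1) (by omega), Finset.sum_range_succ', add_sub_cancel_right]
      refine Submodule.sum_mem _ fun k _ => ?_
      refine Submodule.mem_iSup_of_mem (-((k + 1 : ℕ) : ℤ)) (Submodule.mem_iSup_of_mem (by omega)
        (Module.End.mem_eigenspace_iff.2 ?_))
      rw [hf]
      push_cast
      rfl
    rw [← sub_eq_zero]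
    refine Submodule.disjoint_def.1 (iSupIndep_intCast_eigenspace _ 0) _ h₁ ?_
    rw [← sub_sub_sub_cancel_left N₀ (f 0) N]
    exact Submodule.sub_mem _ h₂ h₃
  refine ⟨f, n₀, hf0, hf, ?_, hsum⟩
  intro k hk
  have hz : ∀ i ∈ (Finset.range (n₀ + k + 1)).erase 0, homBracket Np Np (f i) = 0 := by
    refine eq_zero_of_sum_eq_zero_of_weights (homBracket Y' Y') _ _ ?_ ?_
    · intro i _
      rw [homBracket_homBracket, hf, map_smul]
      rw [show Y' * Np - Np * Y' = 0 from hp]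
      simp [homBracket_apply]
    · rw [← map_sum]
      have : ∑ i ∈ (Finset.range (n₀ + k + 1)).erase 0, f i = N - N₀ := by
        rw [← hsum (n₀ + k + 1) (by omega), ← hf0, eq_sub_iff_add_eq]
        exact Finset.sum_erase_add _ _ (by simp)
      rw [this, homBracket_self, hc, sub_self]
  exact hz k (by simp; omega)

end Gradings

/-- functoriality of the Deligne grading: Let `(W, N, Y)` and `(W̃, Ñ, Ỹ)` be
one-variable Deligne systems on `V` and `Ṽ`, and `T : V → Ṽ` a linear map with
`T(W_i) ⊆ W̃_i`, `Ỹ ∘ T = T ∘ Y` and `Ñ ∘ T = T ∘ N`.  If `Y'` and `Ỹ'` are gradings of `W`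
and `W̃` (commuting with `Y`, resp. `Ỹ`) having the Deligne grading property for the
respective systems, then `Ỹ' ∘ T = T ∘ Y'`. -/
theorem stmt11 {K V Vt : Type} [Field K] [CharZero K]
    [AddCommGroup V] [Module K V] [FiniteDimensional K V]
    [AddCommGroup Vt] [Module K Vt] [FiniteDimensional K Vt]
    (W : ℤ → Submodule K V) (N Y : Module.End K V)
    (Wt : ℤ → Submodule K Vt) (Nt Yt : Module.End K Vt)
    (hDS : IsDeligneSystem1 W N Y) (hDSt : IsDeligneSystem1 Wt Nt Yt)
    (T : V →ₗ[K] Vt)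
    (hTW : ∀ i : ℤ, Submodule.map T (W i) ≤ Wt i)
    (hTY : Yt ∘ₗ T = T ∘ₗ Y)
    (hTN : Nt ∘ₗ T = T ∘ₗ N)
    (Y' : Module.End K V) (Yt' : Module.End K Vt)
    (hY' : IsGrading Y' W) (hY'c : Y * Y' = Y' * Y) (hY'DGP : HasDGP N Y Y')
    (hYt' : IsGrading Yt' Wt) (hYt'c : Yt * Yt' = Yt' * Yt) (hYt'DGP : HasDGP Nt Yt Yt') :
    Yt' ∘ₗ T = T ∘ₗ Y' := by
  obtain ⟨N₀, Np, h₀, hp, ⟨hs₁, hs₂, -⟩, hc⟩ := hY'DGP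
  obtain ⟨Nt₀, Npt, ht₀, hpt, ⟨hst₁, hst₂, -⟩, hct⟩ := hYt'DGP
  obtain ⟨f, a, hf0, hf, hfp, hfs⟩ :=
    exists_components_of_zeroComponent hY' hDS.2.2.1 h₀ hp hc
  obtain ⟨ft, b, hft0, hft, hftp, hfts⟩ :=
    exists_components_of_zeroComponent hYt' hDSt.2.2.1 ht₀ hpt hct
  obtain ⟨v, c, hv, hvs⟩ := exists_components_of_filtered hY' hYt' T hTW
  have hYv : ∀ k ∈ Finset.range (a + b + c + 1), homBracket Yt Y (v k) = 0 := by
    refine eq_zero_of_sum_eq_zero_of_weights (homBracket Yt' Y') _ _ ?_ ?_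
    · intro k _
      rw [homBracket_homBracket, hv, map_smul, hY'c, hYt'c]
      simp [homBracket_apply]
    · rw [← map_sum, hvs _ (by omega), homBracket_apply, hTY, sub_self]
  have key : ∀ k < a + b + c + 1, 1 ≤ k → v k = 0 := by
    refine components_eq_zero (A := homBracket Yt' Y') (D := homBracket (Yt - Yt') (Y - Y'))
      (E := homBracket Npt Np) (B := fun k => homBracket (ft k) (f k)) ?_ ?_ ?_ ?_ hv ?_ ?_
    · intro X
      rw [homBracket_homBracket, hs₁, hst₁]
      congr 1
      ext x
      simp only [homBracket_apply, LinearMap.sub_apply, LinearMap.comp_apply, LinearMap.smul_apply,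
        map_nsmul]
      module
    · intro X
      rw [homBracket_homBracket, hf0, hft0, hs₂, hst₂]
    · intro k X
      rw [homBracket_homBracket, hf, hft, sub_eq_add_neg]
      congr 1
      ext x
      simp only [homBracket_apply, LinearMap.sub_apply, LinearMap.comp_apply, LinearMap.smul_apply,
        LinearMap.neg_apply, map_smul]
      module
    · intro k hk X
      rw [homBracket_homBracket, hfp k hk, hftp k hk]
      simp [homBracket_apply]
    · intro k hk
      have h₁ : homBracket (Yt - Yt') (Y - Y') (v k) =
          homBracket Yt Y (v k) - homBracket Yt' Y' (v k) := by
        ext x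
        simp only [homBracket_apply, LinearMap.sub_apply, LinearMap.comp_apply, map_sub]
        abel
      rw [h₁, hYv k (Finset.mem_range.2 hk), hv, zero_sub, neg_smul, neg_neg]
    · rw [hvs _ (by omega)]
      have h₁ : ∑ i ∈ Finset.range (a + b + c + 1), homBracket (ft i) (f i) T =
          homBracket (∑ i ∈ Finset.range (a + b + c + 1), ft i)
            (∑ i ∈ Finset.range (a + b + c + 1), f i) T := by
        ext x
        simp [homBracket_apply, LinearMap.sum_apply]
      rw [h₁, hfts _ (by omega), hfs _ (by omega), homBracket_apply, hTN, sub_self]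
  have hT0 : T = v 0 := by
    rw [← hvs (a + b + c + 1) (by omega)]
    exact Finset.sum_eq_single_of_mem 0 (by simp) fun k hk hk0 =>
      key k (Finset.mem_range.1 hk) (by omega)
  rw [← sub_eq_zero, ← homBracket_apply, hT0, hv 0]
  simp
end
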